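/- Let U and O be Hopf algebras over k, let ⟨·,·⟩: U × O → k be a Hopf pairing, and let σ ∈ U be an invertible group-like element such that S²(u) = σ u σ⁻¹ for all u ∈ U (so (ε,σ) is a modular pair in involution for U). Let h: O → k be a k-linear functional which is two-sided invariant, i.e. h(f₍₁₎)·f₍₂₎ = h(f)·1 = f₍₁₎·h(f₍₂₎) for all f ∈ O, and modular, i.e. h(fg) = h(g·(σ▷f◁σ)) for all f,g ∈ O. Let θ: O → O be the algebra automorphism θ(f) := f◁σ⁻¹. Then for every n ≥ 0 the k-linear map χ_q: U^⊗n → Hom_k(O^⊗(n+1), k) defined by χ_q(u¹⊗…⊗uⁿ)(f⁰⊗…⊗fⁿ) := h(f⁰·(u¹▷f¹)⋯(uⁿ▷fⁿ)) commutes with all coface operators, codegeneracy operators and cyclic operators of the Connes–Moscovici cocyclic module C•(U,ε,σ) and of the θ-twisted cocyclic module of O; consequently χ_q induces a homomorphism of cyclic cohomology groups HC^n(U, {}^σk) → HC^n_θ(O) for every n ≥ 0. -/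

import Mathlib

/-!
STATEMENT 0: Let `U`, `O` be Hopf algebras over `k` with a Hopf pairing `⟨·,·⟩`, let
`σ ∈ U` be an invertible group-like with `S² = Ad_σ` (so `(ε,σ)` is a modular pair in
involution for `U`), and let `h : O → k` be a two-sided invariant functional which is
modular: `h(fg) = h(g·(σ▷f◁σ))`.  With `θ(f) = f ◁ σ⁻¹`, the maps
`χ_q(u¹,…,uⁿ)(f⁰,…,fⁿ) = h(f⁰·(u¹▷f¹)⋯(uⁿ▷fⁿ))`
commute with all cofaces, codegeneracies and cyclic operators of the Connes–Moscovici
cocyclic module `C•(U,ε,σ)` and of the θ-twisted cocyclic module of `O` (and land in the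
θ-invariant cochains); consequently `χ_q` induces `HC^n(U,{}^σ k) → HC^n_θ(O)`.

Cofaces of `C•(U,ε,σ)` involving `Δ` (the inner cofaces and the cyclic operator, whose
values are not decomposable tensors) are handled by quantifying over all Sweedler
representations of the relevant comultiplications, expressed via evaluation against
arbitrary tuples of linear functionals (which separate points of tensor powers over a
field).
-/

open TensorProduct Coalgebra HopfAlgebra

section Defs

variable {k U O : Type*} [CommSemiring k]

/-- The left coregular action `u ▷ f := f₍₁₎ ⟨u, f₍₂₎⟩` along a pairing `p`. -/
noncomputable def lcoregAct [AddCommMonoid U] [Module k U]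
    [AddCommMonoid O] [Module k O] [CoalgebraStruct k O]
    (p : U →ₗ[k] O →ₗ[k] k) (u : U) (f : O) : O :=
  (TensorProduct.rid k O) ((LinearMap.lTensor O (p u)) (comul f))

/-- The right coregular action `f ◁ u := ⟨u, f₍₁₎⟩ f₍₂₎` along a pairing `p`. -/
noncomputable def rcoregAct [AddCommMonoid U] [Module k U]
    [AddCommMonoid O] [Module k O] [CoalgebraStruct k O]
    (p : U →ₗ[k] O →ₗ[k] k) (u : U) (f : O) : O :=
  (TensorProduct.lid k O) ((LinearMap.rTensor O (p u)) (comul f))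

/-- Evaluation of a pure tensor of linear functionals against the `n`-fold iterated
comultiplication: `x ↦ α₁(x₍₁₎)⋯αₙ(x₍ₙ₎)`. -/
noncomputable def dualIterComul [AddCommMonoid U] [Module k U] [CoalgebraStruct k U] :
    (n : ℕ) → (Fin n → (U →ₗ[k] k)) → (U →ₗ[k] k)
  | 0, _ => counit
  | n + 1, α =>
      (LinearMap.mul' k k) ∘ₗ
        (TensorProduct.map (α 0) (dualIterComul n (Fin.tail α))) ∘ₗ comul

/-- `L` is a Sweedler representation of the `n`-fold iterated comultiplication of `x`:
`Δⁿ⁻¹(x) = Σ_{w ∈ L} w 0 ⊗ ⋯ ⊗ w (n−1)`, expressed by evaluation against arbitrary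
tuples of linear functionals (which separate points of tensor powers over a field). -/
noncomputable def IsSweedlerRep [AddCommMonoid U] [Module k U] [CoalgebraStruct k U]
    (n : ℕ) (x : U) (L : List (Fin n → U)) : Prop :=
  ∀ α : Fin n → (U →ₗ[k] k),
    (L.map fun w => ∏ i : Fin n, α i (w i)).sum = dualIterComul n α x

/-- The Connes–Moscovici characteristic cochain
`χ_q(u)(f) = h(f⁰ · (u¹ ▷ f¹) ⋯ (uⁿ ▷ fⁿ))`. -/
noncomputable def chiQ [AddCommMonoid U] [Module k U]
    [Semiring O] [Module k O] [CoalgebraStruct k O]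
    (p : U →ₗ[k] O →ₗ[k] k) (h : O →ₗ[k] k) {n : ℕ} (u : Fin n → U) :
    (Fin (n + 1) → O) → k :=
  fun f => h (f 0 * (List.ofFn fun i : Fin n => lcoregAct p (u i) (f i.succ)).prod)

/-- Insert the pair `(v, w)` in place of the `i`-th entry of a tuple. -/
def insertPairAt {n : ℕ} (u : Fin n → U) (i : Fin n) (v w : U) : Fin (n + 1) → U :=
  fun j => if h1 : (j : ℕ) < (i : ℕ) then u ⟨j, h1.trans i.isLt⟩
    else if h2 : (j : ℕ) = (i : ℕ) then v
    else if h3 : (j : ℕ) = (i : ℕ) + 1 then w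
    else u ⟨(j : ℕ) - 1, by have := j.isLt; have := i.isLt; omega⟩

/-- The `i`-th simplicial face of a tuple: multiply entries `i` and `i+1`. -/
def faceTuple [Mul O] {n : ℕ} (i : ℕ) (a : Fin (n + 2) → O) : Fin (n + 1) → O :=
  fun j => if (j : ℕ) < i then a (Fin.castSucc j)
    else if (j : ℕ) = i then a (Fin.castSucc j) * a (Fin.succ j)
    else a (Fin.succ j)

/-- The last (θ-twisted) face of a tuple: `(θ(a^{n+1})·a⁰, a¹, …, aⁿ)`. -/
def lastFaceTuple [Mul O] {n : ℕ} (θ : O → O) (a : Fin (n + 2) → O) : Fin (n + 1) → O :=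
  fun j => if (j : ℕ) = 0 then θ (a (Fin.last (n + 1))) * a 0 else a (Fin.castSucc j)

/-- The θ-twisted cyclic rotation of a tuple: `(θ(aⁿ), a⁰, …, a^{n−1})`. -/
def cycTuple {n : ℕ} (θ : O → O) (a : Fin (n + 1) → O) : Fin (n + 1) → O :=
  fun j => if (j : ℕ) = 0 then θ (a (Fin.last n))
    else a ⟨(j : ℕ) - 1, by have := j.isLt; omega⟩

end Defs

section Coregular

variable {k U O : Type*} [CommSemiring k] [Semiring U] [Bialgebra k U]
  [Semiring O] [Bialgebra k O] {p : U →ₗ[k] O →ₗ[k] k}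

/-- The left coregular action as a bilinear map. -/
noncomputable def lcoregHom (p : U →ₗ[k] O →ₗ[k] k) : U →ₗ[k] O →ₗ[k] O :=
  LinearMap.mk₂ k (lcoregAct p) (by simp [lcoregAct, LinearMap.lTensor_add])
    (by simp [lcoregAct, LinearMap.lTensor_smul]) (by simp [lcoregAct]) (by simp [lcoregAct])

theorem lcoregHom_apply (u : U) (f : O) : lcoregHom p u f = lcoregAct p u f := rfl

theorem lcoregAct_eq_sum {ι : Type*} {f : O} (r : Coalgebra.Repr k f ι) (u : U) :
    lcoregAct p u f = ∑ j ∈ r.index, p u (r.right j) • r.left j := by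
  simp [lcoregAct, ← r.eq]

theorem comul_lcoregAct (u : U) (f : O) :
    comul (R := k) (lcoregAct p u f) = (lcoregHom p u).lTensor O (comul f) := by
  have key : ∀ t : O ⊗[k] O, comul (R := k) (TensorProduct.rid k O ((p u).lTensor O t)) =
      ((TensorProduct.rid k O).toLinearMap ∘ₗ (p u).lTensor O).lTensor O
        (TensorProduct.assoc k O O O (comul.rTensor O t)) := by
    intro t
    induction t with
    | zero => simp
    | add x y hx hy => simp only [map_add, hx, hy]
    | tmul x y =>
      simp only [LinearMap.lTensor_tmul, TensorProduct.rid_tmul, map_smul,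
        LinearMap.rTensor_tmul]
      induction comul (R := k) x with
      | zero => simp
      | add x y hx hy => simp only [TensorProduct.add_tmul, smul_add, map_add, hx, hy]
      | tmul a b => simp
  rw [lcoregAct, key, coassoc_apply, ← LinearMap.comp_apply, ← LinearMap.lTensor_comp]
  rfl

theorem comul_rcoregAct (u : U) (f : O) :
    comul (R := k) (rcoregAct p u f) =
      (((TensorProduct.lid k O).toLinearMap ∘ₗ (p u).rTensor O) ∘ₗ comul).rTensor O
        (comul f) := by
  have key : ∀ t : O ⊗[k] O, comul (R := k) (TensorProduct.lid k O ((p u).rTensor O t)) =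
      ((TensorProduct.lid k O).toLinearMap ∘ₗ (p u).rTensor O).rTensor O
        ((TensorProduct.assoc k O O O).symm (comul.lTensor O t)) := by
    intro t
    induction t with
    | zero => simp
    | add x y hx hy => simp only [map_add, hx, hy]
    | tmul y x =>
      simp only [LinearMap.lTensor_tmul, TensorProduct.lid_tmul, map_smul,
        LinearMap.rTensor_tmul]
      induction comul (R := k) x with
      | zero => simp
      | add x y hx hy => simp only [TensorProduct.tmul_add, smul_add, map_add, hx, hy]
      | tmul a b => simp [TensorProduct.smul_tmul']
  rw [rcoregAct, key, coassoc_symm_apply, ← LinearMap.comp_apply, ← LinearMap.rTensor_comp]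

theorem lcoregAct_rcoregAct (u v : U) (f : O) :
    lcoregAct p u (rcoregAct p v f) = rcoregAct p v (lcoregAct p u f) := by
  rw [lcoregAct, comul_rcoregAct]
  change _ = (((TensorProduct.lid k O).toLinearMap ∘ₗ (p v).rTensor O) ∘ₗ comul)
    (lcoregAct p u f)
  rw [lcoregAct]
  induction comul (R := k) f with
  | zero => simp
  | add x y hx hy => simp only [map_add, hx, hy]
  | tmul a b => simp

theorem lcoregAct_one_left (hp : ∀ f : O, p 1 f = counit f) (f : O) :
    lcoregAct p 1 f = f := by
  have : p 1 = counit := LinearMap.ext hp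
  simp [lcoregAct, this]

theorem rcoregAct_one_left (hp : ∀ f : O, p 1 f = counit f) (f : O) :
    rcoregAct p 1 f = f := by
  have : p 1 = counit := LinearMap.ext hp
  simp [rcoregAct, this]

theorem lcoregAct_one_right (hp : ∀ u : U, p u 1 = counit u) (u : U) :
    lcoregAct p u (1 : O) = counit (R := k) u • (1 : O) := by
  simp [lcoregAct, hp, Algebra.TensorProduct.one_def]

theorem rcoregAct_one_right (hp : ∀ u : U, p u 1 = counit u) (u : U) :
    rcoregAct p u (1 : O) = counit (R := k) u • (1 : O) := by
  simp [rcoregAct, hp, Algebra.TensorProduct.one_def]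

theorem lcoregAct_mul_left
    (hp : ∀ (u v : U) (f : O),
      p (u * v) f = LinearMap.mul' k k ((TensorProduct.map (p u) (p v)) (comul f)))
    (u v : U) (f : O) :
    lcoregAct p (u * v) f = lcoregAct p u (lcoregAct p v f) := by
  have huv : p (u * v) = p u ∘ₗ lcoregHom p v := by
    ext g
    rw [hp, LinearMap.comp_apply, lcoregHom_apply, lcoregAct]
    induction comul (R := k) g with
    | zero => simp
    | add x y hx hy => simp only [map_add, hx, hy]
    | tmul a b => simp [mul_comm]
  rw [lcoregAct, huv, LinearMap.lTensor_comp, LinearMap.comp_apply, ← comul_lcoregAct]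
  rfl

theorem rcoregAct_mul_left
    (hp : ∀ (u v : U) (f : O),
      p (u * v) f = LinearMap.mul' k k ((TensorProduct.map (p u) (p v)) (comul f)))
    (u v : U) (f : O) :
    rcoregAct p (u * v) f = rcoregAct p v (rcoregAct p u f) := by
  have huv : p (u * v) =
      p v ∘ₗ ((TensorProduct.lid k O).toLinearMap ∘ₗ (p u).rTensor O) ∘ₗ comul := by
    ext g
    rw [hp, LinearMap.comp_apply, LinearMap.comp_apply]
    induction comul (R := k) g with
    | zero => simp
    | add x y hx hy => simp only [map_add, hx, hy]
    | tmul a b => simp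
  rw [rcoregAct, huv, LinearMap.rTensor_comp, LinearMap.comp_apply, ← comul_rcoregAct]
  rfl

theorem lcoregAct_mul_right
    (hp : ∀ (u : U) (f g : O),
      p u (f * g) = LinearMap.mul' k k ((TensorProduct.map (p.flip f) (p.flip g)) (comul u)))
    (u : U) (f g : O) :
    lcoregAct p u (f * g) = LinearMap.mul' k O
      (TensorProduct.map ((lcoregHom p).flip f) ((lcoregHom p).flip g) (comul u)) := by
  have key : ∀ x : U ⊗[k] U, LinearMap.mul' k O
      (TensorProduct.map ((lcoregHom p).flip f) ((lcoregHom p).flip g) x) =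
      ∑ i ∈ (ℛ k f).index, ∑ j ∈ (ℛ k g).index, LinearMap.mul' k k
        (TensorProduct.map (p.flip ((ℛ k f).right i)) (p.flip ((ℛ k g).right j)) x) •
          ((ℛ k f).left i * (ℛ k g).left j) := by
    intro x
    induction x with
    | zero => simp
    | add x y hx hy => simp only [map_add, hx, hy, add_smul, Finset.sum_add_distrib]
    | tmul a b =>
      simp only [TensorProduct.map_tmul, LinearMap.flip_apply, LinearMap.mul'_apply,
        lcoregHom_apply, lcoregAct_eq_sum (ℛ k f), lcoregAct_eq_sum (ℛ k g),
        Finset.sum_mul_sum, smul_mul_smul_comm]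
  rw [key, lcoregAct, Bialgebra.comul_mul, ← (ℛ k f).eq, ← (ℛ k g).eq, Finset.sum_mul_sum]
  simp [hp]

theorem rcoregAct_mul_right {σ : U}
    (hσ : ∀ f g : O, p σ (f * g) = p σ f * p σ g) (f g : O) :
    rcoregAct p σ (f * g) = rcoregAct p σ f * rcoregAct p σ g := by
  simp only [rcoregAct]
  rw [Bialgebra.comul_mul]
  induction comul (R := k) f with
  | zero => simp
  | add x y hx hy => simp only [add_mul, map_add, hx, hy]
  | tmul a b =>
    induction comul (R := k) g with
    | zero => simp
    | add x y hx hy => simp only [mul_add, map_add, hx, hy]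
    | tmul c d => simp [hσ, mul_smul, smul_comm (p σ c)]

/-- A functional with `h(f₁) f₂ = h(f) 1` is invariant under the left coregular action. -/
theorem apply_lcoregAct {h : O →ₗ[k] k} (hp : ∀ u : U, p u 1 = counit u)
    (hinv : ∀ f : O, TensorProduct.lid k O (h.rTensor O (comul f)) = h f • 1) (u : U) (f : O) :
    h (lcoregAct p u f) = counit (R := k) u * h f := by
  have key : ∀ t : O ⊗[k] O, h (TensorProduct.rid k O ((p u).lTensor O t)) =
      p u (TensorProduct.lid k O (h.rTensor O t)) := by
    intro t
    induction t with
    | zero => simp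
    | add x y hx hy => simp only [map_add, hx, hy]
    | tmul a b => simp [mul_comm]
  rw [lcoregAct, key, hinv, map_smul, hp, smul_eq_mul, mul_comm]

/-- A functional with `f₁ h(f₂) = h(f) 1` is invariant under the right coregular action. -/
theorem apply_rcoregAct {h : O →ₗ[k] k} (hp : ∀ u : U, p u 1 = counit u)
    (hinv : ∀ f : O, TensorProduct.rid k O (h.lTensor O (comul f)) = h f • 1) (u : U) (f : O) :
    h (rcoregAct p u f) = counit (R := k) u * h f := by
  have key : ∀ t : O ⊗[k] O, h (TensorProduct.lid k O ((p u).rTensor O t)) =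
      p u (TensorProduct.rid k O (h.lTensor O t)) := by
    intro t
    induction t with
    | zero => simp
    | add x y hx hy => simp only [map_add, hx, hy]
    | tmul a b => simp [mul_comm]
  rw [rcoregAct, key, hinv, map_smul, hp, smul_eq_mul, mul_comm]

/-- Evaluating an ordered product through the pairing factors through the iterated
comultiplication. -/
theorem pairing_prod_ofFn
    (hp_mul : ∀ (u : U) (f g : O),
      p u (f * g) = LinearMap.mul' k k ((TensorProduct.map (p.flip f) (p.flip g)) (comul u)))
    (hp_one : ∀ u : U, p u 1 = counit u) :
    ∀ {n : ℕ} (b : Fin n → O) (x : U),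
      p x (List.ofFn b).prod = dualIterComul n (fun i => p.flip (b i)) x
  | 0, b, x => by simp [dualIterComul, hp_one]
  | n + 1, b, x => by
    have ih : p.flip (List.ofFn fun i => b (Fin.succ i)).prod =
        dualIterComul n (fun i => p.flip (b (Fin.succ i))) :=
      LinearMap.ext fun y => pairing_prod_ofFn hp_mul hp_one _ y
    rw [List.ofFn_succ, List.prod_cons, hp_mul, ih]
    rfl

theorem comul_prod_ofFn {n : ℕ} (g : Fin n → O) :
    comul (R := k) (List.ofFn g).prod = (List.ofFn fun i => comul (R := k) (g i)).prod := by
  change Bialgebra.comulAlgHom k O _ = _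
  rw [map_list_prod, List.map_ofFn]
  rfl

theorem prod_ofFn_tmul {n : ℕ} (a b : Fin n → O) :
    (List.ofFn fun i => a i ⊗ₜ[k] b i).prod = (List.ofFn a).prod ⊗ₜ[k] (List.ofFn b).prod := by
  induction n with
  | zero => simp [Algebra.TensorProduct.one_def]
  | succ n ih => simp [List.ofFn_succ, ih]

theorem prod_ofFn_smul {n : ℕ} (c : Fin n → k) (a : Fin n → O) :
    (List.ofFn fun i => c i • a i).prod = (∏ i, c i) • (List.ofFn a).prod := by
  induction n with
  | zero => simp
  | succ n ih => rw [List.ofFn_succ, List.prod_cons, ih, smul_mul_smul_comm, Fin.prod_univ_succ,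
      List.ofFn_succ, List.prod_cons]

/-- The module algebra property for ordered products, through a Sweedler representation of
the iterated comultiplication. -/
theorem IsSweedlerRep.sum_prod_lcoregAct
    (hp_mul : ∀ (u : U) (f g : O),
      p u (f * g) = LinearMap.mul' k k ((TensorProduct.map (p.flip f) (p.flip g)) (comul u)))
    (hp_one : ∀ u : U, p u 1 = counit u)
    {n : ℕ} {x : U} {L : List (Fin n → U)} (hL : IsSweedlerRep (k := k) n x L)
    (g : Fin n → O) :
    (L.map fun w => (List.ofFn fun i => lcoregAct p (w i) (g i)).prod).sum =
      lcoregAct p x (List.ofFn g).prod := by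
  set r := fun i => ℛ k (g i) with hr
  have hLHS : ∀ w : Fin n → U, (List.ofFn fun i => lcoregAct p (w i) (g i)).prod =
      ∑ s ∈ Fintype.piFinset fun i => (r i).index,
        (∏ i, p.flip ((r i).right (s i)) (w i)) • (List.ofFn fun i => (r i).left (s i)).prod := by
    intro w
    simp only [lcoregAct_eq_sum (r _), ← prod_ofFn_smul]
    exact (MultilinearMap.mkPiAlgebraFin k n O).map_sum_finset
      (fun i j => p (w i) ((r i).right j) • (r i).left j) fun i => (r i).index
  have hcomul : comul (R := k) (List.ofFn g).prod =
      ∑ s ∈ Fintype.piFinset fun i => (r i).index,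
        (List.ofFn fun i => (r i).left (s i)).prod ⊗ₜ[k]
          (List.ofFn fun i => (r i).right (s i)).prod := by
    simp only [comul_prod_ofFn, ← (r _).eq, ← prod_ofFn_tmul]
    exact (MultilinearMap.mkPiAlgebraFin k n (O ⊗[k] O)).map_sum_finset
      (fun i j => (r i).left j ⊗ₜ[k] (r i).right j) fun i => (r i).index
  have hsum : ∀ M : List (Fin n → U),
      (M.map fun w => (List.ofFn fun i => lcoregAct p (w i) (g i)).prod).sum =
      ∑ s ∈ Fintype.piFinset fun i => (r i).index,
        (M.map fun w => ∏ i, p.flip ((r i).right (s i)) (w i)).sum •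
          (List.ofFn fun i => (r i).left (s i)).prod := by
    intro M
    induction M with
    | nil => simp
    | cons w M ih =>
      simp only [List.map_cons, List.sum_cons, add_smul, Finset.sum_add_distrib, ih, hLHS w]
  rw [hsum, lcoregAct, hcomul]
  simp only [map_sum, LinearMap.lTensor_tmul, TensorProduct.rid_tmul]
  refine Finset.sum_congr rfl fun s _ => ?_
  rw [hL fun i => p.flip ((r i).right (s i)), pairing_prod_ofFn hp_mul hp_one]

end Coregular

section Adjunction

variable {k U O : Type*} [CommRing k] [Ring U] [HopfAlgebra k U]
  [Ring O] [Bialgebra k O] {p : U →ₗ[k] O →ₗ[k] k}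

/-- Integration by parts for an invariant functional. -/
theorem apply_mul_lcoregAct_antipode
    (hp_mul_left : ∀ (u v : U) (f : O),
      p (u * v) f = LinearMap.mul' k k ((TensorProduct.map (p u) (p v)) (comul f)))
    (hp_mul_right : ∀ (u : U) (f g : O),
      p u (f * g) = LinearMap.mul' k k ((TensorProduct.map (p.flip f) (p.flip g)) (comul u)))
    (hp_one_left : ∀ f : O, p 1 f = counit f)
    (hp_one_right : ∀ u : U, p u 1 = counit u)
    {h : O →ₗ[k] k}
    (hinv : ∀ f : O, TensorProduct.lid k O (h.rTensor O (comul f)) = h f • 1)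
    (u : U) (a b : O) :
    h (a * lcoregAct p (antipode k u) b) = h (lcoregAct p u a * b) := by
  let F : U ⊗[k] (U ⊗[k] U) →ₗ[k] k := h ∘ₗ LinearMap.mul' k O ∘ₗ
    TensorProduct.map ((lcoregHom p).flip a)
      ((lcoregHom p).flip b ∘ₗ LinearMap.mul' k U ∘ₗ (antipode k).lTensor U)
  have hright : F (comul.lTensor U (comul u)) = h (lcoregAct p u a * b) := by
    have : ∀ t : U ⊗[k] U, F (comul.lTensor U t) =
        h (lcoregAct p (TensorProduct.rid k U (counit.lTensor U t)) a * b) := by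
      intro t
      induction t with
      | zero => simp [← lcoregHom_apply]
      | add x y hx hy =>
        simp only [map_add, hx, hy, ← lcoregHom_apply, LinearMap.add_apply, add_mul]
      | tmul x y =>
        simp [F, ← lcoregHom_apply, Algebra.algebraMap_eq_smul_one]
        simp [lcoregHom_apply, lcoregAct_one_left hp_one_left]
    rw [this]
    simp
  have hleft : F (TensorProduct.assoc k U U U (comul.rTensor U (comul u))) =
      h (a * lcoregAct p (antipode k u) b) := by
    have : ∀ t : U ⊗[k] U, F (TensorProduct.assoc k U U U (comul.rTensor U t)) =
        h (a * lcoregAct p (antipode k (TensorProduct.lid k U (counit.rTensor U t))) b) := by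
      intro t
      induction t with
      | zero => simp [← lcoregHom_apply]
      | add x y hx hy =>
        simp only [map_add, hx, hy, ← lcoregHom_apply, LinearMap.add_apply, mul_add]
      | tmul x y =>
        have hx : ∀ s : U ⊗[k] U, F (TensorProduct.assoc k U U U (s ⊗ₜ[k] y)) =
            h (LinearMap.mul' k O (TensorProduct.map ((lcoregHom p).flip a)
              ((lcoregHom p).flip (lcoregAct p (antipode k y) b)) s)) := by
          intro s
          induction s with
          | zero => simp
          | add s t hs ht => simp only [TensorProduct.add_tmul, map_add, hs, ht]
          | tmul c d => simp [F, lcoregHom_apply, lcoregAct_mul_left hp_mul_left]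
        rw [LinearMap.rTensor_tmul, hx, ← lcoregAct_mul_right hp_mul_right,
          apply_lcoregAct hp_one_right hinv]
        simp [← lcoregHom_apply]
    rw [this]
    simp
  rw [← hleft, ← hright, coassoc_apply]

end Adjunction

section Tuples

variable {k M O : Type*}

theorem prod_ofFn_faceTuple [Monoid M] {n : ℕ} (i : ℕ) (hi : i ≤ n) (g : Fin (n + 2) → M) :
    (List.ofFn (faceTuple i g)).prod = (List.ofFn g).prod := by
  induction n generalizing i with
  | zero =>
    obtain rfl : i = 0 := by omega
    simp [faceTuple]
  | succ n ih =>
    rw [List.ofFn_succ, List.prod_cons, List.ofFn_succ (f := g), List.prod_cons]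
    cases i with
    | zero =>
      rw [List.ofFn_succ (f := fun i => g (Fin.succ i)), List.prod_cons, ← mul_assoc]
      simp [faceTuple]
    | succ i =>
      have h0 : faceTuple (i + 1) g 0 = g 0 := by simp [faceTuple]
      have hs : (fun j : Fin (n + 1) => faceTuple (i + 1) g j.succ) =
          faceTuple i (fun j => g (Fin.succ j)) := by
        funext j
        simp [faceTuple]
      rw [h0, hs, ih i (by omega)]

theorem prod_ofFn_eq_smul_succAbove [CommSemiring k] [Semiring O] [Algebra k O] {n : ℕ}
    (g : Fin (n + 1) → O) (j : Fin (n + 1)) (c : k) (hj : g j = c • 1) :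
    (List.ofFn g).prod = c • (List.ofFn fun i => g (j.succAbove i)).prod := by
  induction n with
  | zero =>
    obtain rfl := Fin.fin_one_eq_zero j
    simp [hj]
  | succ n ih =>
    rw [List.ofFn_succ, List.prod_cons]
    cases j using Fin.cases with
    | zero => simp [hj]
    | succ j =>
      rw [ih (fun i => g i.succ) j hj, List.ofFn_succ, List.prod_cons]
      simp

end Tuples

theorem stmt0_quantum_characteristic_map_is_cocyclic
    (k : Type*) [Field k] [CharZero k]
    (U : Type*) [Ring U] [HopfAlgebra k U]
    (O : Type*) [Ring O] [HopfAlgebra k O]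
    -- a Hopf pairing `⟨·,·⟩ : U × O → k`
    (p : U →ₗ[k] O →ₗ[k] k)
    (hp_mul_left : ∀ (u v : U) (f : O),
      p (u * v) f = LinearMap.mul' k k ((TensorProduct.map (p u) (p v)) (comul f)))
    (hp_mul_right : ∀ (u : U) (f g : O),
      p u (f * g) = LinearMap.mul' k k ((TensorProduct.map (p.flip f) (p.flip g)) (comul u)))
    (hp_one_left : ∀ f : O, p 1 f = counit f)
    (hp_one_right : ∀ u : U, p u 1 = counit u)
    -- `σ` is an invertible group-like element of `U`
    (σ σinv : U) (hσ : σ * σinv = 1) (hσ' : σinv * σ = 1)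
    (hσgl : comul (R := k) σ = σ ⊗ₜ[k] σ) (hσε : counit (R := k) σ = 1)
    -- `(ε, σ)` is a modular pair in involution: `S² = Ad_σ`
    (hS2 : ∀ u : U, antipode (R := k) (antipode (R := k) u) = σ * u * σinv)
    -- `h` is a two-sided invariant, modular functional on `O`
    (h : O →ₗ[k] k)
    (hinvl : ∀ f : O, (TensorProduct.lid k O) ((LinearMap.rTensor O h) (comul f)) = h f • 1)
    (hinvr : ∀ f : O, (TensorProduct.rid k O) ((LinearMap.lTensor O h) (comul f)) = h f • 1)
    (hmod : ∀ f g : O, h (f * g) = h (g * lcoregAct p σ (rcoregAct p σ f))) :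
    -- `θ(f) = f ◁ σ⁻¹`, the twisting automorphism of `O`
    (let θ : O → O := fun f => rcoregAct p σinv f;
      -- `χ_q` lands in the θ-invariant cochains
      (∀ (n : ℕ) (u : Fin n → U) (f : Fin (n + 1) → O),
        chiQ p h u (fun j => θ (f j)) = chiQ p h u f) ∧
      -- compatibility with the zeroth cofaces: `χ_q(d₀ u) = d₀ (χ_q u)`
      (∀ (n : ℕ) (u : Fin n → U) (f : Fin (n + 2) → O),
        chiQ p h (Fin.cons (1 : U) u) f = chiQ p h u (faceTuple 0 f)) ∧
      -- compatibility with the inner cofaces (through any Sweedler representation of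
      -- `Δ(uⁱ)`): `χ_q(dᵢ u) = dᵢ (χ_q u)`
      (∀ (n : ℕ) (u : Fin n → U) (i : Fin n) (L : List (U × U)),
        comul (R := k) (u i) = (L.map fun vw => vw.1 ⊗ₜ[k] vw.2).sum →
        ∀ f : Fin (n + 2) → O,
          (L.map fun vw => chiQ p h (insertPairAt u i vw.1 vw.2) f).sum
            = chiQ p h u (faceTuple ((i : ℕ) + 1) f)) ∧
      -- compatibility with the last cofaces: `χ_q(d_{n+1} u) = d_{n+1} (χ_q u)`
      (∀ (n : ℕ) (u : Fin n → U) (f : Fin (n + 2) → O),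
        chiQ p h (Fin.snoc u σ) f = chiQ p h u (lastFaceTuple θ f)) ∧
      -- compatibility with the codegeneracies: `χ_q(sⱼ u) = sⱼ (χ_q u)`
      (∀ (n : ℕ) (u : Fin (n + 1) → U) (j : Fin (n + 1)) (f : Fin (n + 1) → O),
        counit (R := k) (u j) * chiQ p h (u ∘ j.succAbove) f
          = chiQ p h u (Fin.insertNth j.succ 1 f)) ∧
      -- compatibility with the cyclic operators (through any Sweedler representation of
      -- the iterated comultiplication of `S(u⁰)`): `χ_q(tₙ u) = tₙ (χ_q u)`
      (∀ (n : ℕ) (u : Fin (n + 1) → U) (L : List (Fin (n + 1) → U)),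
        IsSweedlerRep (k := k) (n + 1) (antipode (R := k) (u 0)) L →
        ∀ f : Fin (n + 2) → O,
          (L.map fun w =>
              chiQ p h (fun i : Fin (n + 1) => w i * (Fin.snoc (Fin.tail u) σ : Fin (n + 1) → U) i) f).sum
            = chiQ p h u (cycTuple θ f))) := by
  have hpσ : ∀ f g : O, p σinv (f * g) = p σinv f * p σinv g := by
    have hcomul : comul (R := k) σinv = σinv ⊗ₜ[k] σinv := by
      refine left_inv_eq_right_inv (a := comul (R := k) σ) ?_ ?_
      · rw [← Bialgebra.comul_mul, hσ', Bialgebra.comul_one]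
      · rw [hσgl, Algebra.TensorProduct.tmul_mul_tmul, hσ, Algebra.TensorProduct.one_def]
    intro f g
    simp [hp_mul_right, hcomul]
  have hεσ : counit (R := k) σinv = 1 := by
    have := congrArg (counit (R := k)) hσ
    simpa [hσε] using this
  have hθ : ∀ f g : O, h (rcoregAct p σinv f * g) = h (g * lcoregAct p σ f) := by
    intro f g
    rw [hmod, ← rcoregAct_mul_left hp_mul_left, hσ', rcoregAct_one_left hp_one_left]
  refine ⟨?_, ?_, ?_, ?_, ?_, ?_⟩
  · intro n u f
    let Θ : O →* O :=
      { toFun := rcoregAct p σinv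
        map_one' := by simp [rcoregAct_one_right hp_one_right, hεσ]
        map_mul' := rcoregAct_mul_right hpσ }
    have hprod : (List.ofFn fun i : Fin n => Θ (lcoregAct p (u i) (f i.succ))).prod =
        Θ (List.ofFn fun i : Fin n => lcoregAct p (u i) (f i.succ)).prod := by
      rw [map_list_prod, List.map_ofFn]
      rfl
    simp only [chiQ, lcoregAct_rcoregAct]
    change h (Θ (f 0) * (List.ofFn fun i : Fin n => Θ (lcoregAct p (u i) (f i.succ))).prod) = _
    rw [hprod, ← map_mul]
    change h (rcoregAct p σinv _) = _
    rw [apply_rcoregAct hp_one_right hinvr, hεσ, one_mul]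
  · intro n u f
    simp [chiQ, List.ofFn_succ, faceTuple, lcoregAct_one_left hp_one_left, mul_assoc]
  · intro n u i L hL f
    obtain _ | n := n
    · exact i.elim0
    let c : Fin (n + 1) → O := fun j =>
      lcoregAct p (u j) (if j < i then f j.succ.castSucc else f j.succ.succ)
    let Φ : O →ₗ[k] k := h ∘ₗ LinearMap.mulLeft k (f 0) ∘ₗ
      (MultilinearMap.mkPiAlgebraFin k (n + 1) O).toLinearMap c i
    have hΦ : ∀ x, Φ x = h (f 0 * (List.ofFn (Function.update c i x)).prod) := fun _ => rfl
    have hterm : ∀ v w : U, chiQ p h (insertPairAt u i v w) f =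
        Φ (lcoregAct p v (f i.succ.castSucc) * lcoregAct p w (f i.succ.succ)) := by
      intro v w
      rw [chiQ, ← prod_ofFn_faceTuple i (by omega), hΦ]
      congr 4
      funext j
      rcases lt_trichotomy j i with hj | rfl | hj
      · have hj' : (j : ℕ) < i := hj
        simp [faceTuple, insertPairAt, c, hj.ne, hj]
      · simp [faceTuple, insertPairAt]
      · have hj' : (i : ℕ) < j := hj
        have h1 : ¬ (j : ℕ) + 1 < i := by omega
        have h2 : (j : ℕ) + 1 ≠ i := by omega
        simp [faceTuple, insertPairAt, c, hj.ne', hj.not_gt, hj'.not_gt, hj'.ne', h1, h2]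
    have hface : chiQ p h u (faceTuple ((i : ℕ) + 1) f) =
        Φ (lcoregAct p (u i) (f i.succ.castSucc * f i.succ.succ)) := by
      rw [chiQ, hΦ]
      have h0 : faceTuple ((i : ℕ) + 1) f 0 = f 0 := by simp [faceTuple]
      rw [h0]
      congr 4
      funext j
      rcases lt_trichotomy j i with hj | rfl | hj
      · have hj' : (j : ℕ) < i := hj
        simp [faceTuple, c, hj.ne, hj]
      · simp [faceTuple]
      · have hj' : (i : ℕ) < j := hj
        simp [faceTuple, c, hj.ne', hj.not_gt, hj'.not_gt, hj'.ne']
    rw [hface, lcoregAct_mul_right hp_mul_right, hL]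
    simp only [hterm, map_list_sum, List.map_map]
    rfl
  · intro n u f
    have hsnoc : chiQ p h (Fin.snoc u σ) f =
        h ((f 0 * (List.ofFn fun i : Fin n => lcoregAct p (u i) (f i.castSucc.succ)).prod) *
          lcoregAct p σ (f (Fin.last (n + 1)))) := by
      rw [chiQ, List.ofFn_succ_last, List.prod_append, ← mul_assoc]
      simp
    rw [hsnoc, ← hθ]
    simp [chiQ, lastFaceTuple, mul_assoc]
  · intro n u j f
    rw [chiQ, chiQ, prod_ofFn_eq_smul_succAbove _ j (counit (R := k) (u j))
      (by simp [lcoregAct_one_right hp_one_right])]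
    have h0 : (Fin.insertNth j.succ 1 f : Fin (n + 2) → O) 0 = f 0 := by
      have := Fin.insertNth_apply_succAbove (α := fun _ => O) j.succ 1 f 0
      simpa using this
    have hs : ∀ i : Fin n,
        (Fin.insertNth j.succ 1 f : Fin (n + 2) → O) (j.succAbove i).succ = f i.succ := by
      intro i
      have := Fin.insertNth_apply_succAbove (α := fun _ => O) j.succ 1 f i.succ
      simpa using this
    simp [h0, hs]
  · intro n u L hL f
    have hsum : (L.map fun w => chiQ p h
          (fun i : Fin (n + 1) => w i * (Fin.snoc (Fin.tail u) σ : Fin (n + 1) → U) i) f).sum =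
        h (f 0 * lcoregAct p (antipode k (u 0)) (List.ofFn fun i : Fin (n + 1) =>
          lcoregAct p ((Fin.snoc (Fin.tail u) σ : Fin (n + 1) → U) i) (f i.succ)).prod) := by
      rw [← hL.sum_prod_lcoregAct hp_mul_right hp_one_right, ← LinearMap.mulLeft_apply (R := k),
        map_list_sum, map_list_sum, List.map_map, List.map_map]
      simp only [chiQ, lcoregAct_mul_left hp_mul_left]
      rfl
    rw [hsum, apply_mul_lcoregAct_antipode hp_mul_left hp_mul_right hp_one_left hp_one_right hinvl,
      List.ofFn_succ_last, List.prod_append, ← mul_assoc]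
    have hcyc : chiQ p h u (cycTuple (fun f => rcoregAct p σinv f) f) =
        h (rcoregAct p σinv (f (Fin.last (n + 1))) * (lcoregAct p (u 0) (f 0) *
          (List.ofFn fun i : Fin n => lcoregAct p (u i.succ) (f i.castSucc.succ)).prod)) := by
      rw [chiQ, List.ofFn_succ, List.prod_cons]
      rfl
    rw [hcyc, hθ]
    simp [Fin.tail]
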